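/- Fix an integer k ≥ 2, and set d = 2·F(4k+2). Let Γ be the additive submonoid of ℕ generated by g0 = 2·F(4k), g1 = 2·F(4k+4) and g2 = 6·(F(4k)/3)·(F(4k+4)/3) + 1 (the semigroup of the singularity of type (F(4k)/3, F(4k+4)/3)(6, 1); here the divisions are exact since 3 divides F(4k) and F(4k+4)), and let R(n) = #(Γ ∩ [0,n]). Then R(j·d) = (j+1)(j+2)/2 for every integer j with 0 ≤ j ≤ d−3. -/

import Mathlib

open Finset in
/-- The lattice points `(i, l)` of the first quadrant with `a * i + b * l ≤ n`
(for positive `a` and `b`). -/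
def trianglePoints (a b n : ℕ) : Finset (ℕ × ℕ) :=
  {p ∈ range (n + 1) ×ˢ range (n + 1) | a * p.1 + b * p.2 ≤ n}

theorem mem_trianglePoints {a b n : ℕ} (ha : 0 < a) (hb : 0 < b) {p : ℕ × ℕ} :
    p ∈ trianglePoints a b n ↔ a * p.1 + b * p.2 ≤ n := by
  simp only [trianglePoints, Finset.mem_filter, Finset.mem_product, Finset.mem_range,
    and_iff_right_iff_imp]
  intro h
  have h₁ := Nat.le_mul_of_pos_left p.1 ha
  have h₂ := Nat.le_mul_of_pos_left p.2 hb
  omega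

theorem card_trianglePoints_boundary {a b : ℕ} (ha : 0 < a) (hb : 0 < b) (n : ℕ) :
    ((trianglePoints a b n).filter fun p => p.1 = 0 ∨ p.2 = 0).card = n / a + n / b + 1 := by
  have h : ((trianglePoints a b n).filter fun p => p.1 = 0 ∨ p.2 = 0) =
      ((Finset.range (n / a + 1)).image fun i => (i, 0)) ∪
        ((Finset.Icc 1 (n / b)).image fun l => (0, l)) := by
    ext ⟨i, l⟩
    simp only [Finset.mem_filter, mem_trianglePoints ha hb, Finset.mem_union, Finset.mem_image,
      Finset.mem_range, Finset.mem_Icc, Prod.mk.injEq, Nat.lt_succ_iff,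
      Nat.le_div_iff_mul_le ha, Nat.le_div_iff_mul_le hb]
    constructor
    · rintro ⟨h, rfl | rfl⟩
      · rcases Nat.eq_zero_or_pos l with rfl | hl
        · exact Or.inl ⟨0, by simp⟩
        · exact Or.inr ⟨l, ⟨hl, by linarith⟩, rfl, rfl⟩
      · exact Or.inl ⟨i, by linarith, rfl, rfl⟩
    · rintro (⟨i, h, rfl, rfl⟩ | ⟨l, ⟨-, h⟩, rfl, rfl⟩)
      · exact ⟨by linarith, Or.inr rfl⟩
      · exact ⟨by linarith, Or.inl rfl⟩
  rw [h, Finset.card_union_of_disjoint, Finset.card_image_of_injective _ (fun _ _ => by simp),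
    Finset.card_image_of_injective _ (fun _ _ => by simp), Finset.card_range, Nat.card_Icc]
  · rw [Nat.add_sub_cancel, add_right_comm]
  · rw [Finset.disjoint_left]
    rintro ⟨i, l⟩
    simp only [Finset.mem_image, Finset.mem_Icc, Prod.mk.injEq]
    rintro ⟨_, _, _, rfl⟩ ⟨_, ⟨_, _⟩, _, rfl⟩
    omega

theorem card_trianglePoints_of_lt {a b n : ℕ} (ha : 0 < a) (hb : 0 < b) (hn : n < a + b) :
    (trianglePoints a b n).card = n / a + n / b + 1 := by
  rw [← card_trianglePoints_boundary ha hb, Finset.filter_true_of_mem]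
  intro p hp
  rw [mem_trianglePoints ha hb] at hp
  by_contra! h
  have h₁ := Nat.le_mul_of_pos_right a (Nat.pos_of_ne_zero h.1)
  have h₂ := Nat.le_mul_of_pos_right b (Nat.pos_of_ne_zero h.2)
  omega

theorem card_trianglePoints_add {a b : ℕ} (ha : 0 < a) (hb : 0 < b) (n : ℕ) :
    (trianglePoints a b (n + (a + b))).card = (trianglePoints a b n).card +
      ((n + (a + b)) / a + (n + (a + b)) / b + 1) := by
  rw [← card_trianglePoints_boundary ha hb,
    ← Finset.card_filter_add_card_filter_not (fun p : ℕ × ℕ => p.1 = 0 ∨ p.2 = 0), add_comm]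
  congr 1
  rw [← Finset.card_image_of_injective (trianglePoints a b n)
    (f := fun p => (p.1 + 1, p.2 + 1)) (fun p q => by simp [Prod.ext_iff])]
  congr 1
  ext ⟨i, l⟩
  simp only [Finset.mem_filter, mem_trianglePoints ha hb, Finset.mem_image, Prod.mk.injEq,
    Prod.exists, not_or]
  constructor
  · rintro ⟨h, hi, hl⟩
    obtain ⟨i, rfl⟩ := Nat.exists_eq_succ_of_ne_zero hi
    obtain ⟨l, rfl⟩ := Nat.exists_eq_succ_of_ne_zero hl
    exact ⟨i, l, by simp only [Nat.succ_eq_add_one] at h; linarith, rfl, rfl⟩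
  · rintro ⟨i, l, h, rfl, rfl⟩
    exact ⟨by linarith, by omega, by omega⟩

theorem Int.ediv_sub_sub_one_ediv {a : ℤ} (ha : 0 < a) (q : ℤ) :
    q / a - (q - 1) / a = if a ∣ q then 1 else 0 := by
  split_ifs with h
  · obtain ⟨t, rfl⟩ := h
    rw [Int.mul_ediv_cancel_left _ ha.ne']
    have : (a * t - 1) / a = t - 1 := by
      rw [Int.ediv_eq_iff_of_pos ha]
      constructor <;> linarith
    omega
  · have h₁ := Int.mul_ediv_add_emod q a
    have h₂ := Int.emod_nonneg q ha.ne'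
    have h₃ := Int.emod_lt_of_pos q ha
    have h₄ : q % a ≠ 0 := fun h' => h (Int.dvd_of_emod_eq_zero h')
    have : (q - 1) / a = q / a := by
      rw [Int.ediv_eq_iff_of_pos ha]
      constructor <;> nlinarith [lt_of_le_of_ne h₂ (Ne.symm h₄)]
    omega

/-- The excess of the number of lattice points in the triangle `3 * (a * i + b * l) ≤ j * (a + b)`
over `(j + 1) * (j + 2) / 2`, where `j = r * (a + b) + 3 * q`. -/
def triangleExcess (a : ℤ) : ℕ → ℤ → ℤ
  | 0, q => q / a
  | 1, q => max (q / a + 1) 0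
  | _, _ => 0

theorem div_add_div_eq {a b j q : ℤ} {r : ℕ} (ha : 0 < a) (hab : 2 * a < b)
    (h : a ^ 2 + b ^ 2 = 7 * a * b + 1) (hj₀ : 0 ≤ j) (hj : j ≤ 2 * (a + b) - 3) (hr : r < 3)
    (hq : j = r * (a + b) + 3 * q) :
    j * (a + b) / (3 * a) + j * (a + b) / (3 * b) + 1 =
      3 * j + (triangleExcess a r q - triangleExcess a r (q - 1)) := by
  have hb : 0 < b := by linarith
  have ha3 : 0 < 3 * a := by linarith
  have hb3 : 0 < 3 * b := by linarith
  have hx := Int.mul_ediv_add_emod (j * (a + b)) (3 * a)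
  have hu₀ := Int.emod_nonneg (j * (a + b)) ha3.ne'
  have hu := Int.emod_lt_of_pos (j * (a + b)) ha3
  have hu_eq : ∀ c t, j * (a + b) = c + 3 * a * t → 0 ≤ c → c < 3 * a →
      j * (a + b) % (3 * a) = c := fun c t h hc hc' => by
    rw [h, Int.add_mul_emod_self_left, Int.emod_eq_of_lt hc hc']
  have hy := Int.mul_ediv_add_emod (j * (a + b)) (3 * b)
  have hv₀ := Int.emod_nonneg (j * (a + b)) hb3.ne'
  have hv := Int.emod_lt_of_pos (j * (a + b)) hb3
  generalize j * (a + b) / (3 * a) = x at *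
  generalize j * (a + b) % (3 * a) = u at *
  generalize j * (a + b) / (3 * b) = y at *
  generalize j * (a + b) % (3 * b) = v at *
  have key : u * b + v * a - j = 3 * a * b * (3 * j - x - y) := by
    linear_combination b * hx + a * hy + j * h
  have hs : 3 * j - x - y = 0 ∨ 3 * j - x - y = 1 := by
    have hab' : 0 < a * b := mul_pos ha hb
    have h₁ : -1 < 3 * j - x - y := by
      by_contra! hc
      nlinarith [mul_nonneg hu₀ hb.le, mul_nonneg hv₀ ha.le]
    have h₂ : 3 * j - x - y < 2 := by
      by_contra! hc
      nlinarith
    omega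
  have hres : j * (a + b) = r + 3 * (3 * r * (a * b) + q * (a + b)) := by
    rw [hq]
    linear_combination (r : ℤ) * h
  have hu3 : ∃ t, u = r + 3 * t := ⟨3 * r * (a * b) + q * (a + b) - a * x, by linarith⟩
  have hv3 : ∃ t, v = r + 3 * t := ⟨3 * r * (a * b) + q * (a + b) - b * y, by linarith⟩
  have hu2 : 3 * j - x - y = 0 → u ≤ 2 := by
    intro h0
    rw [h0] at key
    by_contra! hc
    nlinarith
  obtain ⟨s, rfl⟩ := hu3
  obtain ⟨t, rfl⟩ := hv3
  interval_cases r
  · have hE := Int.ediv_sub_sub_one_ediv ha q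
    simp only [triangleExcess]
    rw [hE]
    split_ifs with hd
    · obtain ⟨c, rfl⟩ := hd
      have := hu_eq 0 (c * (a + b)) (by rw [hq]; push_cast; ring) le_rfl ha3
      rcases hs with hs | hs
      · linarith
      · rw [hs] at key
        rw [this] at key
        nlinarith
    · rcases hs with hs | hs
      · refine absurd ?_ hd
        have := hu2 hs
        rw [hs] at key
        have hs0 : s = 0 := by push_cast at *; omega
        subst hs0
        exact ⟨t, by push_cast at *; linarith⟩
      · linarith
  · have hE := Int.ediv_sub_sub_one_ediv ha q
    have hE' : triangleExcess a 1 q - triangleExcess a 1 (q - 1) =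
        if 0 ≤ q ∧ a ∣ q then 1 else 0 := by
      simp only [triangleExcess]
      rcases lt_or_ge q 0 with h0 | h0
      · have h₁ := Int.ediv_neg_of_neg_of_pos h0 ha
        have h₂ : (q - 1) / a < 0 := Int.ediv_neg_of_neg_of_pos (by linarith) ha
        rw [if_neg (by omega)]
        omega
      · have h₁ := Int.ediv_nonneg h0 ha.le
        have h₂ : -1 ≤ (q - 1) / a := by
          rw [Int.le_ediv_iff_mul_le ha]
          linarith
        simp only [h0, true_and]
        rw [← hE]
        omega
    rw [hE']
    split_ifs with hd
    · obtain ⟨h0, c, rfl⟩ := hd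
      have := hu_eq 1 (3 * b + c * (a + b)) (by rw [hres]; push_cast; ring) (by norm_num)
        (by linarith)
      rcases hs with hs | hs
      · linarith
      · rw [hs] at key
        rw [this] at key
        push_cast at *
        nlinarith
    · rcases hs with hs | hs
      · refine absurd ?_ hd
        have := hu2 hs
        rw [hs] at key
        have hs0 : s = 0 := by push_cast at *; omega
        have ht0 : 0 ≤ t := by push_cast at *; omega
        subst hs0
        have hqt : q = a * t := by push_cast at *; linarith
        exact ⟨hqt ▸ mul_nonneg ha.le ht0, t, hqt⟩
      · linarith
  · simp only [triangleExcess]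
    rcases hs with hs | hs
    · rw [hs] at key
      have hs0 : 0 ≤ s := by push_cast at *; omega
      have ht0 : 0 ≤ t := by push_cast at *; omega
      push_cast at *
      nlinarith [mul_nonneg hs0 hb.le, mul_nonneg ht0 ha.le]
    · linarith

theorem two_mul_card_trianglePoints {a b : ℕ} (ha : 0 < a) (hab : 2 * a < b)
    (h : a ^ 2 + b ^ 2 = 7 * a * b + 1) (j : ℕ) (hj : j + 3 ≤ 2 * (a + b)) {r : ℕ} (hr : r < 3)
    {q : ℤ} (hq : (j : ℤ) = r * (a + b) + 3 * q) :
    2 * ((trianglePoints a b (j * (a + b) / 3)).card : ℤ) =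
      (j + 1) * (j + 2) + 2 * triangleExcess a r q := by
  have hb : 0 < b := by omega
  induction j using Nat.strong_induction_on generalizing q with
  | _ j ih =>
  have hdiv := div_add_div_eq (a := a) (b := b) (j := j) (q := q) (r := r) (by exact_mod_cast ha)
    (by exact_mod_cast hab) (by exact_mod_cast h) (by positivity) (by omega) hr hq
  have hE0 : j < 3 → 2 * (3 * (j : ℤ) + (triangleExcess a r q - triangleExcess a r (q - 1))) =
      (j + 1) * (j + 2) + 2 * triangleExcess a r q := by
    intro hj3
    interval_cases r
    · obtain rfl : j = 0 := by omega
      obtain rfl : q = 0 := by simpa using hq.symm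
      have : (-1 : ℤ) / a = -1 := Int.ediv_eq_neg_one_of_neg_of_le (by omega) (by omega)
      simp [triangleExcess, this]
    · have h₁ : (q - 1) / (a : ℤ) < 0 :=
        Int.ediv_neg_of_neg_of_pos (by push_cast at hq; omega) (by omega)
      have h₂ : max ((q - 1) / (a : ℤ) + 1) 0 = 0 := by omega
      have h₃ : j ≠ 0 := by
        rintro rfl
        have h₄ : ((a + b) ^ 2 : ℤ) = 9 * (a * b) + 1 := by
          zify at h
          linear_combination h
        have h₅ : (a + b : ℤ) = 3 * -q := by push_cast at hq; linarith
        rw [h₅] at h₄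
        have : (3 * -q) ^ 2 = 9 * q ^ 2 := by ring
        omega
      simp only [triangleExcess, h₂]
      obtain rfl | rfl : j = 1 ∨ j = 2 := by omega
      all_goals norm_num [mul_add]
    · have h₃ : j ≠ 0 := by
        rintro rfl
        have h₄ : (4 * (a + b) ^ 2 : ℤ) = 36 * (a * b) + 4 := by
          zify at h
          linear_combination 4 * h
        have h₅ : (2 * (a + b) : ℤ) = 3 * -q := by push_cast at hq; linarith
        have : (4 * (a + b) ^ 2 : ℤ) = 9 * q ^ 2 := by
          linear_combination (2 * (a + b) - 3 * q : ℤ) * h₅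
        omega
      simp only [triangleExcess]
      obtain rfl | rfl : j = 1 ∨ j = 2 := by omega
      all_goals norm_num
  have hcard : ((j * (a + b) / 3 / a + j * (a + b) / 3 / b + 1 : ℕ) : ℤ) =
      3 * j + (triangleExcess a r q - triangleExcess a r (q - 1)) := by
    rw [Nat.div_div_eq_div_mul, Nat.div_div_eq_div_mul, ← hdiv]
    push_cast
    rfl
  rcases lt_or_ge j 3 with hj3 | hj3
  · rw [card_trianglePoints_of_lt ha hb, hcard, hE0 hj3]
    rw [Nat.div_lt_iff_lt_mul (by norm_num)]
    nlinarith
  · obtain ⟨i, rfl⟩ := Nat.exists_eq_add_of_le' hj3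
    have hi := ih i (by omega) (by omega) (q := q - 1) (by push_cast at hq; linarith)
    have hstep : (i + 3) * (a + b) / 3 = i * (a + b) / 3 + (a + b) := by
      rw [add_mul, Nat.add_mul_div_left _ _ (by norm_num)]
    rw [hstep] at hcard ⊢
    rw [card_trianglePoints_add ha hb]
    push_cast at hcard hi ⊢
    linarith

/-- The semigroup element `6 * a * i + 6 * b * l + i / b`, where `i / b` is the multiplicity of the
generator `6 * a * b + 1`. -/
def semigroupValue (a b : ℕ) (p : ℕ × ℕ) : ℕ :=
  6 * (a * p.1 + b * p.2) + p.1 / b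

theorem mem_closure_iff_exists_semigroupValue {a b : ℕ} (hb : 0 < b) (hab : a ≤ b)
    (h : a ^ 2 + b ^ 2 = 7 * a * b + 1) {x : ℕ} :
    x ∈ AddSubmonoid.closure ({6 * a, 6 * b, 6 * a * b + 1} : Set ℕ) ↔
      ∃ p, semigroupValue a b p = x := by
  constructor
  · intro hx
    obtain ⟨A, B, C, rfl⟩ : ∃ A B C, x = A * (6 * a) + B * (6 * b) + C * (6 * a * b + 1) := by
      induction hx using AddSubmonoid.closure_induction with
      | mem x hx =>
        rcases hx with rfl | rfl | rfl
        · exact ⟨1, 0, 0, by ring⟩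
        · exact ⟨0, 1, 0, by ring⟩
        · exact ⟨0, 0, 1, by ring⟩
      | zero => exact ⟨0, 0, 0, by ring⟩
      | add x y _ _ hx hy =>
        obtain ⟨A, B, C, rfl⟩ := hx
        obtain ⟨A', B', C', rfl⟩ := hy
        exact ⟨A + A', B + B', C + C', by ring⟩
    obtain ⟨e, rfl⟩ := Nat.exists_eq_add_of_le hab
    set A' := A + a * (C / 6)
    refine ⟨(A' % (a + e) + (a + e) * (C % 6), B + e * (C / 6) + a * (A' / (a + e))), ?_⟩
    have hA := Nat.mod_add_div A' (a + e)
    have hC := Nat.mod_add_div C 6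
    have hA' : A' = A + a * (C / 6) := rfl
    have hdiv : (A' % (a + e) + (a + e) * (C % 6)) / (a + e) = C % 6 := by
      rw [Nat.add_mul_div_left _ _ hb, Nat.div_eq_of_lt (Nat.mod_lt _ hb), zero_add]
    simp only [semigroupValue, hdiv]
    generalize A' % (a + e) = i at *
    generalize A' / (a + e) = m at *
    generalize C % 6 = c at *
    generalize C / 6 = n at *
    subst hC
    rw [hA'] at hA
    zify at *
    linear_combination 6 * (a : ℤ) * hA + 6 * n * h
  · rintro ⟨p, rfl⟩
    have hp : semigroupValue a b p =
        (p.1 % b) • (6 * a) + p.2 • (6 * b) + (p.1 / b) • (6 * a * b + 1) := by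
      have := Nat.mod_add_div p.1 b
      simp only [semigroupValue, smul_eq_mul]
      nth_rewrite 1 [← this]
      ring
    rw [hp]
    refine add_mem (add_mem ?_ ?_) ?_ <;>
      exact AddSubmonoid.nsmul_mem _ (AddSubmonoid.subset_closure (by simp)) _

theorem semigroupValue_injOn {a b : ℕ} (hb : 0 < b) (h : IsCoprime (a : ℤ) b) :
    Set.InjOn (semigroupValue a b) {p | p.1 / b < 6} := by
  rintro ⟨i, l⟩ hp ⟨i', l'⟩ hp' heq
  simp only [Set.mem_ofPred_eq, semigroupValue] at hp hp' heq
  have hdiv : i / b = i' / b := by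
    generalize i / b = c at *
    generalize i' / b = c' at *
    omega
  have hlin : a * i + b * l = a * i' + b * l' := by omega
  have hdvd : (b : ℤ) ∣ i' - i := by
    refine h.symm.dvd_of_dvd_mul_left ⟨l - l', ?_⟩
    zify at hlin
    linear_combination -hlin
  have hmod : i % b = i' % b := Nat.modEq_iff_dvd.2 hdvd
  obtain rfl : i = i' := by rw [← Nat.mod_add_div i b, ← Nat.mod_add_div i' b, hdiv, hmod]
  have : b * l = b * l' := by omega
  rw [Nat.eq_of_mul_eq_mul_left hb this]

theorem mem_Icc_iff_of_residue {a b q s : ℤ} {r : ℕ} (ha : 0 < a) (hab : 2 * a < b)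
    (hr : r < 3) (hq₀ : 0 ≤ r * (a + b) + 3 * q) (hq : r * (a + b) + 3 * q ≤ 2 * (a + b) - 3) :
    (2 * r + 1) * b ≤ q + b * s ∧ 0 ≤ q + a * (3 * r - s) ↔
      s ∈ Finset.Icc (3 * r + if r = 0 then 1 else 0 : ℤ) (3 * r + q / a) := by
  have hdiv : 0 ≤ q + a * (3 * r - s) ↔ s ≤ 3 * r + q / a := by
    rw [← sub_le_iff_le_add' (b := (3 * r : ℤ)), Int.le_ediv_iff_mul_le ha]
    constructor <;> intro h <;> linarith
  rw [Finset.mem_Icc, ← hdiv]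
  refine and_congr_left fun h => ?_
  interval_cases r <;> norm_num at * <;> constructor <;> intro h'
  · by_contra! hs
    nlinarith
  · nlinarith
  · by_contra! hs
    nlinarith
  · nlinarith
  · by_contra! hs
    nlinarith
  · nlinarith

theorem card_filter_lt_semigroupValue {a b : ℕ} (ha : 0 < a) (hab : 2 * a < b)
    (h : a ^ 2 + b ^ 2 = 7 * a * b + 1) (h_cop : IsCoprime (a : ℤ) b) {j : ℕ}
    (hj : j + 3 ≤ 2 * (a + b)) {r : ℕ} (hr : r < 3) {q : ℤ}
    (hq : (j : ℤ) = r * (a + b) + 3 * q) :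
    (((trianglePoints a b (j * (a + b) / 3)).filter
      fun p => ¬ semigroupValue a b p ≤ 2 * (j * (a + b))).card : ℤ) = triangleExcess a r q := by
  have hb : 0 < b := by omega
  have hres : ((j * (a + b) : ℕ) : ℤ) = 3 * (q * (a + b) + 3 * r * (a * b)) + r := by
    zify at h
    push_cast
    rw [hq]
    linear_combination (r : ℤ) * h
  have hlt : j * (a + b) < 18 * (a * b) := by nlinarith
  have hset : ((trianglePoints a b (j * (a + b) / 3)).filter
      fun p => ¬ semigroupValue a b p ≤ 2 * (j * (a + b))) =
      (Finset.Icc (3 * r + if r = 0 then 1 else 0 : ℤ) (3 * r + q / a)).image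
        fun s => ((q + b * s).toNat, (q + a * (3 * r - s)).toNat) := by
    ext ⟨i, l⟩
    simp only [Finset.mem_filter, mem_trianglePoints ha hb, Finset.mem_image, Prod.mk.injEq,
      semigroupValue, not_le]
    have hmem := fun s => mem_Icc_iff_of_residue (a := a) (b := b) (q := q) (s := s) (r := r)
      (by omega) (by omega) hr (by omega) (by omega)
    simp only [← hmem]
    have hiff : a * i + b * l ≤ j * (a + b) / 3 ∧ 2 * (j * (a + b)) < 6 * (a * i + b * l) + i / b ↔
        (a * i + b * l : ℤ) = q * (a + b) + 3 * r * (a * b) ∧ ((2 * r + 1) * b : ℤ) ≤ i := by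
      have hib : ((2 * r + 1) * b : ℤ) ≤ i ↔ 2 * r + 1 ≤ i / b := by
        rw [Nat.le_div_iff_mul_le hb]
        zify
      rw [hib]
      have hi : a * i + b * l ≤ j * (a + b) / 3 → i / b < 6 := by
        intro h'
        rw [Nat.div_lt_iff_lt_mul hb]
        have : 3 * (a * i + b * l) < 18 * (a * b) := by omega
        by_contra! hc
        nlinarith [Nat.mul_le_mul_left a hc, Nat.zero_le (b * l)]
      have hw : ((a * i + b * l : ℕ) : ℤ) = a * i + b * l := by push_cast; ring
      rw [← hw]
      generalize a * i + b * l = w at *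
      generalize j * (a + b) = N at *
      generalize q * (a + b : ℤ) + 3 * r * (a * b) = M at *
      omega
    rw [hiff]
    constructor
    · rintro ⟨hw, hi⟩
      obtain ⟨s, hs⟩ : (b : ℤ) ∣ i - q := by
        refine h_cop.symm.dvd_of_dvd_mul_left ⟨q + 3 * r * a - l, ?_⟩
        linear_combination hw
      have hi' : (i : ℤ) = q + b * s := by linarith
      have hl' : (l : ℤ) = q + a * (3 * r - s) := by
        have : (b : ℤ) ≠ 0 := by positivity
        apply mul_left_cancel₀ this
        rw [hi'] at hw
        linear_combination hw
      refine ⟨s, ⟨?_, ?_⟩, ?_, ?_⟩ <;> omega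
    · rintro ⟨s, ⟨h₁, h₂⟩, rfl, rfl⟩
      have h₃ : 0 ≤ q + b * s := le_trans (by positivity) h₁
      rw [Int.toNat_of_nonneg h₂, Int.toNat_of_nonneg h₃]
      exact ⟨by ring, h₁⟩
  have hinj : Set.InjOn (fun s : ℤ => ((q + b * s).toNat, (q + a * (3 * r - s)).toNat))
      (Finset.Icc (3 * r + if r = 0 then 1 else 0 : ℤ) (3 * r + q / a) : Finset ℤ) := by
    intro s hs t ht hst
    rw [Finset.mem_coe, ← mem_Icc_iff_of_residue (b := b) (by omega) (by omega) hr (by omega)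
      (by omega)] at hs ht
    have h₁ := congrArg Prod.snd hst
    have h₂ : (a : ℤ) * (3 * r - s) = a * (3 * r - t) := by
      have := hs.2
      have := ht.2
      simp only at h₁
      omega
    have h₃ := mul_left_cancel₀ (by omega) h₂
    linarith
  rw [hset, Finset.card_image_of_injOn hinj, Int.card_Icc]
  interval_cases r
  · have : 0 ≤ q / (a : ℤ) := Int.ediv_nonneg (by push_cast at hq; omega) (by omega)
    simp [triangleExcess, this]
  · simp only [triangleExcess]
    push_cast
    simp
    ring_nf
  · have : q / (a : ℤ) < 0 := Int.ediv_neg_of_neg_of_pos (by push_cast at hq; omega) (by omega)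
    simp [triangleExcess]
    omega

theorem ncard_semigroup_le {a b : ℕ} (ha : 0 < a) (hab : 2 * a < b)
    (h : a ^ 2 + b ^ 2 = 7 * a * b + 1) {j : ℕ} (hj : j + 3 ≤ 2 * (a + b)) :
    {x : ℕ | x ∈ AddSubmonoid.closure ({6 * a, 6 * b, 6 * a * b + 1} : Set ℕ) ∧
      x ≤ j * (2 * (a + b))}.ncard = (j + 1) * (j + 2) / 2 := by
  have hb : 0 < b := by omega
  have h_cop : IsCoprime (a : ℤ) b := by
    refine ⟨a - 7 * b, b, ?_⟩
    zify at h
    linear_combination h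
  have hlt : j * (a + b) < 18 * (a * b) := by nlinarith
  have hset : {x : ℕ | x ∈ AddSubmonoid.closure ({6 * a, 6 * b, 6 * a * b + 1} : Set ℕ) ∧
      x ≤ j * (2 * (a + b))} = (((trianglePoints a b (j * (a + b) / 3)).filter
        fun p => semigroupValue a b p ≤ 2 * (j * (a + b))).image (semigroupValue a b) :
          Finset ℕ) := by
    ext x
    simp only [Set.mem_ofPred_eq, mem_closure_iff_exists_semigroupValue hb (by omega : a ≤ b) h,
      Finset.coe_image, Finset.coe_filter, Set.mem_image, mem_trianglePoints ha hb,
      mul_left_comm j 2]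
    constructor
    · rintro ⟨⟨p, rfl⟩, hp⟩
      refine ⟨p, ⟨?_, hp⟩, rfl⟩
      simp only [semigroupValue] at hp
      generalize p.1 / b = c at hp
      omega
    · rintro ⟨p, ⟨-, hp⟩, rfl⟩
      exact ⟨⟨p, rfl⟩, hp⟩
  rw [hset, Set.ncard_coe_finset, Finset.card_image_of_injOn]
  · obtain ⟨r, hr, q, hq⟩ : ∃ r < 3, ∃ q : ℤ, (j : ℤ) = (r : ℕ) * (a + b) + 3 * q := by
      refine ⟨j * (a + b) % 3, Nat.mod_lt _ (by norm_num),
        (j * (a + b) / 3 : ℕ) * (a + b) - 3 * (a * b) * j, ?_⟩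
      have hm := Nat.mod_add_div (j * (a + b)) 3
      zify at hm h ⊢
      linear_combination -(a + b : ℤ) * hm - j * h
    have h₁ := two_mul_card_trianglePoints ha hab h j hj hr hq
    have h₂ := card_filter_lt_semigroupValue ha hab h h_cop hj hr hq
    have h₃ := Finset.card_filter_add_card_filter_not
      (s := trianglePoints a b (j * (a + b) / 3))
      (fun p => semigroupValue a b p ≤ 2 * (j * (a + b)))
    symm
    apply Nat.div_eq_of_eq_mul_right (by norm_num)
    have h₄ : ((j + 1) * (j + 2) : ℕ) = ((j : ℤ) + 1) * (j + 2) := by push_cast; rfl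
    omega
  · refine (semigroupValue_injOn hb h_cop).mono fun p hp => ?_
    simp only [Finset.coe_filter, Set.mem_ofPred_eq, mem_trianglePoints ha hb] at hp
    rw [Set.mem_ofPred_eq, Nat.div_lt_iff_lt_mul hb]
    have : 3 * (a * p.1 + b * p.2) < 18 * (a * b) := by omega
    by_contra! hc
    nlinarith [Nat.mul_le_mul_left a hc, Nat.zero_le (b * p.2)]

theorem Nat.fib_odd_sq_add_mul (m : ℕ) :
    Nat.fib (2 * m + 1) ^ 2 + Nat.fib (2 * m + 1) * Nat.fib (2 * m + 2) =
      Nat.fib (2 * m + 2) ^ 2 + 1 := by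
  induction m with
  | zero => simp
  | succ m ih =>
    have h₁ : Nat.fib (2 * (m + 1) + 1) = Nat.fib (2 * m + 1) + Nat.fib (2 * m + 2) :=
      Nat.fib_add_two
    have h₂ : Nat.fib (2 * (m + 1) + 2) = Nat.fib (2 * m + 2) + Nat.fib (2 * (m + 1) + 1) :=
      Nat.fib_add_two
    rw [h₂, h₁]
    nlinarith

/-- Family (viii): for `k ≥ 2` and `d = 2·F(4k+2)`, the semigroup generated by
`2·F(4k)`, `2·F(4k+4)`, `6·(F(4k)/3)·(F(4k+4)/3) + 1` (singularity of type
`(F(4k)/3, F(4k+4)/3)(6,1)`) satisfies the Borodzik–Livingston counting condition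
`R(j·d) = (j+1)(j+2)/2` for `0 ≤ j ≤ d−3`. -/
theorem counting_condition_family_viii
    (k d : ℕ) (hk : 2 ≤ k) (hd : d = 2 * Nat.fib (4 * k + 2)) :
    ∀ j : ℕ, j ≤ d - 3 →
      {x : ℕ | x ∈ AddSubmonoid.closure
          ({2 * Nat.fib (4 * k), 2 * Nat.fib (4 * k + 4),
            6 * (Nat.fib (4 * k) / 3) * (Nat.fib (4 * k + 4) / 3) + 1} : Set ℕ) ∧
        x ≤ j * d}.ncard = (j + 1) * (j + 2) / 2 := by
  intro j hj
  obtain ⟨a, ha⟩ : 3 ∣ Nat.fib (4 * k) := Nat.fib_dvd 4 (4 * k) ⟨k, rfl⟩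
  obtain ⟨b, hb⟩ : 3 ∣ Nat.fib (4 * k + 4) := Nat.fib_dvd 4 (4 * k + 4) ⟨k + 1, rfl⟩
  have h₂ : Nat.fib (4 * k + 2) = Nat.fib (4 * k) + Nat.fib (4 * k + 1) := Nat.fib_add_two
  have h₃ : Nat.fib (4 * k + 3) = Nat.fib (4 * k + 1) + Nat.fib (4 * k + 2) := Nat.fib_add_two
  have h₄ : Nat.fib (4 * k + 4) = Nat.fib (4 * k + 2) + Nat.fib (4 * k + 3) := Nat.fib_add_two
  have h_cassini := Nat.fib_odd_sq_add_mul (2 * k)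
  rw [← mul_assoc, show 2 * 2 = 4 from rfl] at h_cassini
  have h_pos : 0 < Nat.fib (4 * k) := Nat.fib_pos.2 (by omega)
  have h_pos' : 0 < Nat.fib (4 * k + 1) := Nat.fib_pos.2 (by omega)
  have hf : Nat.fib (4 * k + 2) = a + b := by omega
  have hx : Nat.fib (4 * k + 1) + 2 * a = b := by omega
  have h : a ^ 2 + b ^ 2 = 7 * a * b + 1 := by
    rw [hf] at h_cassini
    zify at hx h_cassini ⊢
    rw [← eq_sub_iff_add_eq] at hx
    rw [hx] at h_cassini
    linear_combination h_cassini
  rw [ha, hb, Nat.mul_div_cancel_left _ (by norm_num), Nat.mul_div_cancel_left _ (by norm_num),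
    ← mul_assoc, ← mul_assoc, hd, hf]
  exact ncard_semigroup_le (by omega) (by omega) h (by omega)
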